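/- Let Ω ⊆ ℝ^N be Lebesgue measurable with |Ω| < ∞ and assume D̄ := dim̄_B(∞,Ω) < −N. Suppose the tube zeta function ζ̃_{∞,Ω} admits a meromorphic continuation to an open connected neighborhood U of the critical line {Re s = D̄}, that D̄ is its only pole in U, and that this pole is simple. Then D := dim_B(∞,Ω) exists, D = D̄, and Ω is Minkowski measurable at infinity with 𝓜^D(∞,Ω) = lim_{s→D} (s−D)ζ̃_{∞,Ω}(s). The same conclusion holds with the distance zeta function ζ_{∞,Ω} in place of ζ̃_{∞,Ω}, in which case 𝓜^D(∞,Ω) = (lim_{s→D}(s−D)ζ_{∞,Ω}(s))/(−(N+D)). -/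

import Mathlib

open MeasureTheory Filter Set Complex Topology
open scoped ENNReal Real

noncomputable section

/-- The "tail" of `Ω` beyond radius `t`: the complement of the open Euclidean ball of
radius `t` centered at `0`, intersected with `Ω`. -/
def tailSet (N : ℕ) (Ω : Set (EuclideanSpace ℝ (Fin N))) (t : ℝ) :
    Set (EuclideanSpace ℝ (Fin N)) :=
  {x | x ∈ Ω ∧ t ≤ ‖x‖}

/-- The tube function `t ↦ |_tΩ|` at infinity. -/
def tubeVol (N : ℕ) (Ω : Set (EuclideanSpace ℝ (Fin N))) (t : ℝ) : ℝ :=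
  (volume (tailSet N Ω t)).toReal

/-- Upper `r`-dimensional Minkowski content of `Ω` at infinity. -/
def upperMinkContent (N : ℕ) (Ω : Set (EuclideanSpace ℝ (Fin N))) (r : ℝ) : ℝ≥0∞ :=
  Filter.limsup (fun t : ℝ => volume (tailSet N Ω t) / ENNReal.ofReal (t ^ ((N : ℝ) + r)))
    Filter.atTop

/-- Lower `r`-dimensional Minkowski content of `Ω` at infinity. -/
def lowerMinkContent (N : ℕ) (Ω : Set (EuclideanSpace ℝ (Fin N))) (r : ℝ) : ℝ≥0∞ :=
  Filter.liminf (fun t : ℝ => volume (tailSet N Ω t) / ENNReal.ofReal (t ^ ((N : ℝ) + r)))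
    Filter.atTop

/-- Upper Minkowski dimension of `Ω` at infinity. -/
def upperMinkDim (N : ℕ) (Ω : Set (EuclideanSpace ℝ (Fin N))) : ℝ :=
  sInf {r : ℝ | upperMinkContent N Ω r = 0}

/-- Lower Minkowski dimension of `Ω` at infinity. -/
def lowerMinkDim (N : ℕ) (Ω : Set (EuclideanSpace ℝ (Fin N))) : ℝ :=
  sInf {r : ℝ | lowerMinkContent N Ω r = 0}

/-- Distance (Lapidus) zeta function of `Ω` at infinity. -/
def distZeta (N : ℕ) (Ω : Set (EuclideanSpace ℝ (Fin N))) (T : ℝ) (s : ℂ) : ℂ :=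
  ∫ x in tailSet N Ω T, (‖x‖ : ℂ) ^ (-s - (N : ℂ))

/-- Tube zeta function of `Ω` at infinity. -/
def tubeZeta (N : ℕ) (Ω : Set (EuclideanSpace ℝ (Fin N))) (T : ℝ) (s : ℂ) : ℂ :=
  ∫ t in Set.Ioi T, (t : ℂ) ^ (-s - (N : ℂ) - 1) * ((tubeVol N Ω t : ℝ) : ℂ)

/-- Abscissa of (absolute) convergence of the distance zeta function at infinity. -/
def distAbscissa (N : ℕ) (Ω : Set (EuclideanSpace ℝ (Fin N))) (T : ℝ) : ℝ :=
  sInf {σ : ℝ | ∀ s : ℂ, σ < s.re →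
    IntegrableOn (fun x => (‖x‖ : ℂ) ^ (-s - (N : ℂ))) (tailSet N Ω T) volume}

/-- Abscissa of (absolute) convergence of the tube zeta function at infinity. -/
def tubeAbscissa (N : ℕ) (Ω : Set (EuclideanSpace ℝ (Fin N))) (T : ℝ) : ℝ :=
  sInf {σ : ℝ | ∀ s : ℂ, σ < s.re →
    IntegrableOn (fun t : ℝ => (t : ℂ) ^ (-s - (N : ℂ) - 1) * ((tubeVol N Ω t : ℝ) : ℂ))
      (Set.Ioi T) volume}

/-- The triangle function, whose Fourier transform is the Fejér kernel. -/
def triangle (t : ℝ) : ℝ := max (1 - |t|) 0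

/-- The Fejér kernel on the real line, up to normalization. -/
def fejerKernel (u : ℝ) : ℝ := Real.sinc (u / 2) ^ 2

lemma continuous_triangle : Continuous triangle := by
  unfold triangle; fun_prop

lemma hasCompactSupport_triangle : HasCompactSupport triangle := by
  refine HasCompactSupport.intro (K := Icc (-1) 1) isCompact_Icc fun t ht => ?_
  unfold triangle
  refine max_eq_right ?_
  by_contra! h
  exact ht (abs_le.mp (by linarith))

lemma continuous_fejerKernel : Continuous fejerKernel := by
  unfold fejerKernel
  exact (Real.continuous_sinc.comp (by fun_prop)).pow 2

lemma fejerKernel_nonneg (u : ℝ) : 0 ≤ fejerKernel u := sq_nonneg _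

lemma sq_mul_fejerKernel (u : ℝ) : u ^ 2 * fejerKernel u = 2 * (1 - Real.cos u) := by
  have h : Real.cos u = 1 - 2 * Real.sin (u / 2) ^ 2 := by
    rw [← Real.cos_two_mul_eq_one_sub]; congr 1; ring
  rcases eq_or_ne u 0 with rfl | hu
  · simp
  · rw [fejerKernel, Real.sinc_of_ne_zero (by simpa using hu), h]
    field_simp
    ring

lemma integrable_fejerKernel : Integrable fejerKernel := by
  refine (integrable_inv_one_add_sq.const_mul 5).mono'
    continuous_fejerKernel.aestronglyMeasurable (.of_forall fun u => ?_)
  rw [Real.norm_of_nonneg (fejerKernel_nonneg u), ← div_eq_mul_inv, le_div_iff₀ (by positivity)]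
  have h1 : fejerKernel u ≤ 1 := by
    rw [fejerKernel, ← sq_abs]
    exact pow_le_one₀ (abs_nonneg _) (Real.abs_sinc_le_one _)
  nlinarith [sq_mul_fejerKernel u, Real.neg_one_le_cos u]

lemma integral_fejerKernel_pos : 0 < ∫ u, fejerKernel u := by
  rw [integral_pos_iff_support_of_nonneg fejerKernel_nonneg integrable_fejerKernel]
  exact continuous_fejerKernel.isOpen_support.measure_pos _ ⟨0, by simp [fejerKernel]⟩

lemma integral_triangle_mul (f : ℝ → ℂ) (hf : Continuous f) :
    ∫ t, (triangle t : ℂ) * f t =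
      (∫ t in (-1 : ℝ)..0, (1 + t : ℂ) * f t) + ∫ t in (0 : ℝ)..1, (1 - t : ℂ) * f t := by
  have hc : Continuous fun t => (triangle t : ℂ) * f t := by
    have := continuous_triangle; fun_prop
  have h1 : ∫ t, (triangle t : ℂ) * f t = ∫ t in (-1 : ℝ)..1, (triangle t : ℂ) * f t := by
    rw [intervalIntegral.integral_of_le (by norm_num),
      setIntegral_eq_integral_of_forall_compl_eq_zero]
    intro t ht
    have : triangle t = 0 := by
      refine max_eq_right ?_
      by_contra! h
      have := abs_lt.mp (show |t| < 1 by linarith)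
      exact ht ⟨this.1, this.2.le⟩
    simp [this]
  rw [h1, ← intervalIntegral.integral_add_adjacent_intervals (hc.intervalIntegrable (-1) 0)
    (hc.intervalIntegrable 0 1)]
  congr 1
  · refine intervalIntegral.integral_congr fun t ht => ?_
    rw [uIcc_of_le (by norm_num)] at ht
    have : triangle t = 1 + t := by
      rw [triangle, abs_of_nonpos ht.2, max_eq_left] <;> linarith [ht.1]
    simp [this]
  · refine intervalIntegral.integral_congr fun t ht => ?_
    rw [uIcc_of_le (by norm_num)] at ht
    have : triangle t = 1 - t := by
      rw [triangle, abs_of_nonneg ht.1, max_eq_left]; linarith [ht.2]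
    simp [this]

lemma integral_triangle_mul_exp {w : ℂ} (hw : w ≠ 0) :
    ∫ t, (triangle t : ℂ) * cexp (w * t) = (cexp w + cexp (-w) - 2) / w ^ 2 := by
  rw [integral_triangle_mul _ (by fun_prop)]
  have key (σ : ℂ) (hσ : σ ^ 2 = 1) (t : ℝ) : HasDerivAt
      (fun t : ℝ => ((1 + σ * t) / w - σ / w ^ 2) * cexp (w * t))
      ((1 + σ * t : ℂ) * cexp (w * t)) t := by
    have h1 : HasDerivAt (fun t : ℝ => (t : ℂ)) 1 t := Complex.ofRealCLM.hasDerivAt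
    have h2 := ((((h1.const_mul σ).const_add 1).div_const w).sub_const (σ / w ^ 2)).mul
      ((h1.const_mul w).cexp)
    refine h2.congr_deriv ?_
    field_simp
    ring
  have e1 := intervalIntegral.integral_eq_sub_of_hasDerivAt (a := -1) (b := 0)
    (fun t _ => key 1 (by norm_num) t) (Continuous.intervalIntegrable (by fun_prop) _ _)
  have e2 := intervalIntegral.integral_eq_sub_of_hasDerivAt (a := 0) (b := 1)
    (fun t _ => key (-1) (by norm_num) t) (Continuous.intervalIntegrable (by fun_prop) _ _)
  simp only [one_mul, neg_mul, ← sub_eq_add_neg] at e1 e2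
  rw [e1, e2]
  push_cast
  simp only [mul_zero, mul_one, mul_neg, Complex.exp_zero]
  field_simp
  ring

lemma fejerKernel_eq_integral (u : ℝ) :
    (fejerKernel u : ℂ) = ∫ t, (triangle t : ℂ) * cexp (-(I * t * u)) := by
  rcases eq_or_ne u 0 with rfl | hu
  · have h := integral_triangle_mul (fun _ => 1) continuous_const
    simp only [mul_one] at h
    simp only [fejerKernel, ofReal_zero, mul_zero, neg_zero, Complex.exp_zero, mul_one, h]
    have e1 : (∫ t in (-1 : ℝ)..0, (1 + t : ℂ)) = ((∫ t in (-1 : ℝ)..0, (1 + t : ℝ) : ℝ) : ℂ) := by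
      rw [← intervalIntegral.integral_ofReal]; simp
    have e2 : (∫ t in (0 : ℝ)..1, (1 - t : ℂ)) = ((∫ t in (0 : ℝ)..1, (1 - t : ℝ) : ℝ) : ℂ) := by
      rw [← intervalIntegral.integral_ofReal]; simp
    rw [e1, e2, intervalIntegral.integral_add (by simp) (by simp),
      intervalIntegral.integral_sub (by simp) (by simp)]
    simp
    norm_num
  · have hw : -(I * (u : ℂ)) ≠ 0 := by simpa using hu
    have h := integral_triangle_mul_exp hw
    have e : ∀ t : ℝ, cexp (-(I * t * u)) = cexp (-(I * (u : ℂ)) * t) := fun t => by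
      congr 1; ring
    simp only [e, h]
    have hs : (u : ℂ) ^ 2 * fejerKernel u = 2 * (1 - Complex.cos u) := by
      exact_mod_cast congrArg (Complex.ofReal) (sq_mul_fejerKernel u)
    have hu' : (u : ℂ) ≠ 0 := by exact_mod_cast hu
    rw [eq_div_iff (pow_ne_zero 2 hw), neg_sq, mul_pow, I_sq]
    rw [Complex.cos] at hs
    rw [neg_neg, mul_comm I (u : ℂ), ← neg_mul]
    linear_combination -hs

lemma mul_fejerKernel_eq_integral {l : ℝ} (hl : 0 < l) (u : ℝ) :
    ((l * fejerKernel (l * u) : ℝ) : ℂ) =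
      ∫ t, (triangle (t / l) : ℂ) * cexp (-(I * t * u)) := by
  have h := Measure.integral_comp_div
    (fun t : ℝ => (triangle t : ℂ) * cexp (-(I * t * (l * u : ℝ)))) l
  rw [← fejerKernel_eq_integral, abs_of_pos hl] at h
  rw [ofReal_mul, ← real_smul, ← h]
  refine integral_congr_ae (.of_forall fun t => ?_)
  have : (l : ℂ) ≠ 0 := by exact_mod_cast hl.ne'
  simp only [ofReal_div, ofReal_mul]
  congr 3
  field_simp

lemma norm_cexp_neg_I_mul_mul (t u : ℝ) : ‖cexp (-(I * t * u))‖ = 1 := by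
  rw [show -(I * (t : ℂ) * u) = ((-(t * u) : ℝ) : ℂ) * I by push_cast; ring]
  exact norm_exp_ofReal_mul_I _

lemma integrable_prod_mul_exp {f k : ℝ → ℝ} (hf : Integrable f) (hk : Integrable k) (y : ℝ) :
    Integrable (Function.uncurry fun x t : ℝ =>
      (f x : ℂ) * ((k t : ℂ) * cexp (-(I * t * (x - y : ℝ))))) (volume.prod volume) := by
  have h := (hf.ofReal (𝕜 := ℂ)).mul_prod (hk.ofReal (𝕜 := ℂ))
  refine (h.bdd_mul (f := fun z : ℝ × ℝ => cexp (-(I * z.2 * (z.1 - y : ℝ)))) (c := 1)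
    (Continuous.aestronglyMeasurable (by fun_prop))
    (.of_forall fun z => (norm_cexp_neg_I_mul_mul _ _).le)).congr (.of_forall fun z => ?_)
  simp only [Function.uncurry]
  simp only [coe_algebraMap]
  ring

section Kernel

variable {k κ : ℝ → ℝ}

/-- Fubini's theorem for the pairing of `f` with a translated Fourier transform. -/
lemma integral_mul_kernel_eq (hk : Integrable k)
    (hκ : ∀ u : ℝ, (κ u : ℂ) = ∫ t, (k t : ℂ) * cexp (-(I * t * u)))
    {f : ℝ → ℝ} (hf : Integrable f) (y : ℝ) :
    Integrable (fun x => f x * κ (x - y)) ∧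
    ((∫ x, f x * κ (x - y) : ℝ) : ℂ) =
      ∫ t, (k t : ℂ) * cexp (I * t * y) * ∫ x, (f x : ℂ) * cexp (-(I * t * x)) := by
  have hi := integrable_prod_mul_exp hf hk y
  have e (x : ℝ) : ((f x * κ (x - y) : ℝ) : ℂ) =
      ∫ t : ℝ, (f x : ℂ) * ((k t : ℂ) * cexp (-(I * t * (x - y : ℝ)))) := by
    rw [ofReal_mul, hκ, integral_const_mul]
  constructor
  · have := hi.integral_prod_left
    simp only [Function.uncurry, ← e] at this
    simpa using this.re
  · rw [← integral_complex_ofReal]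
    simp only [e]
    rw [integral_integral_swap hi]
    refine integral_congr_ae (.of_forall fun t => ?_)
    simp only
    rw [← integral_const_mul]
    refine integral_congr_ae (.of_forall fun x => ?_)
    simp only
    rw [show -(I * (t : ℂ) * (x - y : ℝ)) = I * t * y + -(I * t * x) by push_cast; ring,
      Complex.exp_add]
    ring

/-- If `F` is continuous near the imaginary axis, then its pairing with a compactly supported
function on the line `Re z = ε` converges to the one on the imaginary axis. -/
lemma tendsto_integral_vertical_line {U : Set ℂ} (hU : IsOpen U)
    (hline : ∀ z : ℂ, z.re = 0 → z ∈ U) {F : ℂ → ℂ} (hF : ContinuousOn F U) {q : ℝ → ℂ}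
    (hq : Continuous q) (hqs : HasCompactSupport q) :
    (∀ᶠ ε : ℝ in 𝓝 0, ∀ t ∈ tsupport q, (ε + I * t : ℂ) ∈ U) ∧
    (∀ᶠ ε : ℝ in 𝓝 0, Integrable fun t : ℝ => q t * F (ε + I * t)) ∧
    Tendsto (fun ε : ℝ => ∫ t, q t * F (ε + I * t)) (𝓝 0) (𝓝 (∫ t : ℝ, q t * F (I * t))) := by
  have hc : Continuous fun p : ℝ × ℝ => (p.1 + I * p.2 : ℂ) := by fun_prop
  obtain ⟨u, v, hu, hv, h0u, hv', huv⟩ := generalized_tube_lemma (s := {(0 : ℝ)})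
    isCompact_singleton hqs.isCompact (hU.preimage hc) (by
      rintro ⟨ε, t⟩ ⟨h, -⟩
      refine hline _ ?_
      simp only [mem_singleton_iff] at h
      simp [h])
  obtain ⟨d, hd, hdu⟩ := Metric.nhds_basis_closedBall.mem_iff.mp
    (hu.mem_nhds (h0u rfl))
  have hev : ∀ᶠ ε : ℝ in 𝓝 0, ε ∈ Metric.closedBall (0 : ℝ) d := Metric.closedBall_mem_nhds _ hd
  have hmem : ∀ ε ∈ Metric.closedBall (0 : ℝ) d, ∀ t ∈ tsupport q, (ε + I * t : ℂ) ∈ U :=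
    fun ε hε t ht => huv (show (ε, t) ∈ u ×ˢ v from ⟨hdu hε, hv' ht⟩)
  obtain ⟨C, hC⟩ := ((isCompact_closedBall (0 : ℝ) d).prod hqs.isCompact).exists_bound_of_continuousOn
    (f := fun p : ℝ × ℝ => F (p.1 + I * p.2))
    (hF.comp hc.continuousOn fun p hp => hmem p.1 hp.1 p.2 hp.2)
  have hcont : ∀ ε ∈ Metric.closedBall (0 : ℝ) d, Continuous fun t : ℝ => q t * F (ε + I * t) := by
    intro ε hε
    rw [continuous_iff_continuousAt]
    intro t
    by_cases ht : t ∈ tsupport q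
    · exact hq.continuousAt.mul (((hF.continuousAt (hU.mem_nhds (hmem ε hε t ht)))).comp
        (f := fun t : ℝ => (ε + I * t : ℂ)) (by fun_prop))
    · have := notMem_tsupport_iff_eventuallyEq.mp ht
      refine continuousAt_const (y := (0 : ℂ)) |>.congr ?_
      filter_upwards [this] with t ht
      simp [ht]
  have hbound : ∀ ε ∈ Metric.closedBall (0 : ℝ) d, ∀ t : ℝ,
      ‖q t * F (ε + I * t)‖ ≤ ‖q t‖ * C := by
    intro ε hε t
    by_cases ht : t ∈ tsupport q
    · rw [norm_mul]
      gcongr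
      exact hC (ε, t) ⟨hε, ht⟩
    · simp [image_eq_zero_of_notMem_tsupport ht]
  have hbi : Integrable fun t => ‖q t‖ * C :=
    (hq.integrable_of_hasCompactSupport hqs).norm.mul_const C
  refine ⟨hev.mono hmem, hev.mono fun ε hε => ?_, ?_⟩
  · exact hbi.mono' (hcont ε hε).aestronglyMeasurable (.of_forall (hbound ε hε))
  · refine tendsto_integral_filter_of_dominated_convergence _
      (hev.mono fun ε hε => (hcont ε hε).aestronglyMeasurable)
      (hev.mono fun ε hε => .of_forall (hbound ε hε)) hbi (.of_forall fun t => ?_)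
    refine Tendsto.const_mul _ ?_
    have h1 : Tendsto (fun ε : ℝ => (ε + I * t : ℂ)) (𝓝 0) (𝓝 (I * t)) := by
      have : Continuous fun ε : ℝ => (ε + I * t : ℂ) := by fun_prop
      simpa using this.tendsto 0
    exact (hF.continuousAt (hU.mem_nhds (hline _ (by simp)))).tendsto.comp h1

lemma tendsto_integral_mul_exp_atTop (q : ℝ → ℂ) :
    Tendsto (fun y : ℝ => ∫ t : ℝ, q t * cexp (I * t * y)) atTop (𝓝 0) := by
  have h := (Real.tendsto_integral_exp_smul_cocompact q).comp
    (g := fun w => ∫ v : ℝ, Real.fourierChar (-(v * w)) • q v)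
    (f := fun y : ℝ => -(2 * π)⁻¹ * y) (x := atTop) ?_
  · refine h.congr fun y => integral_congr_ae (.of_forall fun t => ?_)
    simp only [Circle.smul_def, Real.fourierChar_apply, smul_eq_mul]
    rw [mul_comm]
    congr 2
    have : (π : ℂ) ≠ 0 := by exact_mod_cast Real.pi_ne_zero
    push_cast
    field_simp
  · refine Tendsto.mono_right ?_ atBot_le_cocompact
    exact tendsto_id.const_mul_atTop_of_neg (by simp [Real.pi_pos])

/-- The Wiener–Ikehara argument: convolution with an admissible kernel of a function whose
Laplace transform has, on the imaginary axis, only a simple pole at the origin. -/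
theorem tendsto_integral_mul_kernel {h : ℝ → ℝ} {L M : ℝ} (hm : Measurable h)
    (h0 : ∀ x, 0 ≤ h x) (hL : ∀ x < L, h x = 0)
    (hexpInt : ∀ ε > 0, Integrable fun x => h x * Real.exp (-(ε * x)))
    {U : Set ℂ} (hU : IsOpen U) (hline : ∀ z : ℂ, z.re = 0 → z ∈ U)
    {F : ℂ → ℂ} (hF : ContinuousOn F U)
    (hFe : ∀ z ∈ U, 0 < z.re → F z = (∫ x : ℝ, (h x : ℂ) * cexp (-(z * x))) - M / z)
    (hk : Continuous k) (hks : HasCompactSupport k)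
    (hκc : Continuous κ) (hκ0 : ∀ u, 0 ≤ κ u) (hκi : Integrable κ)
    (hκ : ∀ u : ℝ, (κ u : ℂ) = ∫ t, (k t : ℂ) * cexp (-(I * t * u))) :
    (∀ y, Integrable fun x => h x * κ (x - y)) ∧
      Tendsto (fun y => ∫ x, h x * κ (x - y)) atTop (𝓝 (M * ∫ u, κ u)) := by
  have hki : Integrable k := hk.integrable_of_hasCompactSupport hks
  have hpos : ∀ᶠ ε : ℝ in 𝓝[>] 0, 0 < ε := self_mem_nhdsWithin
  have hle : ∀ᶠ ε : ℝ in 𝓝[>] 0, ε < 1 := nhdsWithin_le_nhds (Iio_mem_nhds one_pos)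
  let H : ℝ → ℝ := (Ioi 0).indicator 1
  have hHint : ∀ ε > 0, Integrable fun x => H x * Real.exp (-(ε * x)) := by
    intro ε hε
    have : (fun x => H x * Real.exp (-(ε * x))) =
        (Ioi 0).indicator fun x => Real.exp (-ε * x) := by
      ext x; by_cases hx : x ∈ Ioi (0 : ℝ) <;> simp [H, hx]
    rw [this, integrable_indicator_iff measurableSet_Ioi]
    exact exp_neg_integrableOn_Ioi 0 hε
  have hHlap : ∀ z : ℂ, 0 < z.re → ∫ x : ℝ, (H x : ℂ) * cexp (-(z * x)) = 1 / z := by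
    intro z hz
    have : (fun x : ℝ => (H x : ℂ) * cexp (-(z * x))) =
        (Ioi 0).indicator fun x : ℝ => cexp (-z * x) := by
      ext x; by_cases hx : x ∈ Ioi (0 : ℝ) <;> simp [H, hx]
    rw [this, integral_indicator measurableSet_Ioi, integral_exp_mul_complex_Ioi (by simpa)]
    simp
  have hexp (f : ℝ → ℝ) (ε t : ℝ) : ∫ x : ℝ, ((f x * Real.exp (-(ε * x)) : ℝ) : ℂ) *
      cexp (-(I * t * x)) = ∫ x : ℝ, (f x : ℂ) * cexp (-((ε + I * t) * x)) := by
    refine integral_congr_ae (.of_forall fun x => ?_)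
    simp only
    rw [show -((ε + I * t) * x : ℂ) = ((-(ε * x) : ℝ) : ℂ) + -(I * t * x) by push_cast; ring,
      Complex.exp_add]
    push_cast
    ring
  let J : ℝ → ℂ := fun y => ∫ t : ℝ, (k t : ℂ) * cexp (I * t * y) * F (I * t)
  let B : ℝ → ℝ := fun y => ∫ x, H x * κ (x - y)
  have hdom (f : ℝ → ℝ) (c : ℝ) (hfm : Measurable f) (hf0 : ∀ x, 0 ≤ f x)
      (hfc : ∀ x < c, f x = 0) (y : ℝ) (hi : Integrable fun x => f x * κ (x - y)) :
      Tendsto (fun ε : ℝ => ∫ x, f x * Real.exp (-(ε * x)) * κ (x - y)) (𝓝[>] 0)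
        (𝓝 (∫ x, f x * κ (x - y))) := by
    refine tendsto_integral_filter_of_dominated_convergence
      (fun x => f x * κ (x - y) * Real.exp |c|) (.of_forall fun ε => ?_) ?_ (hi.mul_const _)
      (.of_forall fun x => ?_)
    · exact Measurable.aestronglyMeasurable (by have := hκc.measurable; fun_prop)
    · filter_upwards [hpos, hle] with ε h1 h2
      refine .of_forall fun x => ?_
      rw [Real.norm_of_nonneg (mul_nonneg (mul_nonneg (hf0 x) (Real.exp_pos _).le) (hκ0 _)),
        mul_right_comm]
      rcases lt_or_ge x c with hx | hx
      · simp [hfc x hx]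
      · have := hf0 x
        have := hκ0 (x - y)
        gcongr
        rcases le_total 0 x with h | h
        · have := mul_nonneg h1.le h
          linarith [abs_nonneg c]
        · have := neg_abs_le c
          nlinarith
    · have : Continuous fun ε : ℝ => f x * Real.exp (-(ε * x)) * κ (x - y) := by fun_prop
      simpa using (this.tendsto 0).mono_left nhdsWithin_le_nhds
  have hHi (y : ℝ) : Integrable fun x => H x * κ (x - y) := by
    have : (fun x => H x * κ (x - y)) = (Ioi 0).indicator fun x => κ (x - y) := by
      ext x; by_cases hx : x ∈ Ioi (0 : ℝ) <;> simp [H, hx]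
    rw [this]
    exact (hκi.comp_sub_right y).indicator measurableSet_Ioi
  have hBlim (y : ℝ) := hdom H 0 (measurable_one.indicator measurableSet_Ioi)
    (fun x => indicator_nonneg (by simp) x)
    (fun x hx => indicator_of_notMem (by simpa using hx.le) _) y (hHi y)
  have hAlim (y : ℝ) : Tendsto
      (fun ε : ℝ => ((∫ x, h x * Real.exp (-(ε * x)) * κ (x - y) : ℝ) : ℂ)) (𝓝[>] 0)
      (𝓝 (J y + M * B y)) := by
    have hq : Continuous fun t : ℝ => (k t : ℂ) * cexp (I * t * y) := by fun_prop
    have hqs : HasCompactSupport fun t : ℝ => (k t : ℂ) * cexp (I * t * y) :=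
      (hks.comp_left (g := ((↑) : ℝ → ℂ)) ofReal_zero).mul_right
    obtain ⟨hmem, hFi, hFlim⟩ := tendsto_integral_vertical_line hU hline hF hq hqs
    refine ((hFlim.mono_left nhdsWithin_le_nhds).add
      (((continuous_ofReal.tendsto _).comp (hBlim y)).const_mul (M : ℂ))).congr' ?_
    filter_upwards [nhdsWithin_le_nhds hmem, nhdsWithin_le_nhds hFi, hpos] with ε h1 h2 h3
    rw [(integral_mul_kernel_eq hki hκ (hexpInt ε h3) y).2, Function.comp,
      (integral_mul_kernel_eq hki hκ (hHint ε h3) y).2]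
    have hre (t : ℝ) : (0 : ℝ) < (ε + I * t : ℂ).re := by simpa using h3
    simp only [hexp, hHlap _ (hre _)]
    have hne (t : ℝ) : (ε + I * t : ℂ) ≠ 0 := fun h => by simpa [h] using hre t
    have hinv : Integrable fun t : ℝ => (k t : ℂ) * cexp (I * t * y) * (1 / (ε + I * t)) :=
      Continuous.integrable_of_hasCompactSupport (by fun_prop (disch := exact hne _)) hqs.mul_right
    rw [← integral_const_mul, ← integral_add h2 (hinv.const_mul _)]
    refine integral_congr_ae (.of_forall fun t => ?_)
    simp only
    by_cases ht : t ∈ tsupport fun t : ℝ => (k t : ℂ) * cexp (I * t * y)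
    · rw [hFe _ (h1 t ht) (hre t)]
      ring
    · rw [show (k t : ℂ) * cexp (I * t * y) = 0 from
        image_eq_zero_of_notMem_tsupport (f := fun t : ℝ => (k t : ℂ) * cexp (I * t * y)) ht]
      ring
  have hAi (y : ℝ) : Integrable fun x => h x * κ (x - y) := by
    have hseq : Tendsto (fun n : ℕ => 1 / ((n : ℝ) + 1)) atTop (𝓝[>] 0) :=
      tendsto_nhdsWithin_iff.mpr ⟨tendsto_one_div_add_atTop_nhds_zero_nat,
        .of_forall fun n => by simp only [mem_Ioi]; positivity⟩
    refine integrable_of_tendsto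
      (G := fun n x => h x * Real.exp (-(1 / ((n : ℝ) + 1) * x)) * κ (x - y))
      (.of_forall fun x => ?_) (fun n => ?_) ?_
    · have : Continuous fun ε : ℝ => h x * Real.exp (-(ε * x)) * κ (x - y) := by fun_prop
      simpa [Function.comp_def] using (this.tendsto 0).comp tendsto_one_div_add_atTop_nhds_zero_nat
    · exact Measurable.aestronglyMeasurable (by have := hκc.measurable; fun_prop)
    · have hlim := ENNReal.tendsto_ofReal
        ((continuous_re.tendsto _).comp ((hAlim y).comp hseq))
      refine ne_of_eq_of_ne (Tendsto.liminf_eq (hlim.congr fun n => ?_)) ENNReal.ofReal_ne_top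
      simp only [Function.comp, ofReal_re]
      have hn : 0 < 1 / ((n : ℝ) + 1) := by positivity
      rw [ofReal_integral_eq_lintegral_ofReal (integral_mul_kernel_eq hki hκ (hexpInt _ hn) y).1
        (.of_forall fun x => mul_nonneg (mul_nonneg (h0 x) (Real.exp_pos _).le) (hκ0 _))]
      refine lintegral_congr fun x => ?_
      rw [← Real.enorm_of_nonneg (mul_nonneg (mul_nonneg (h0 x) (Real.exp_pos _).le) (hκ0 _))]
  refine ⟨hAi, ?_⟩
  have hA (y : ℝ) : ∫ x, h x * κ (x - y) = (J y).re + M * B y := by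
    have e1 := (continuous_re.tendsto _).comp (hAlim y)
    have := tendsto_nhds_unique (hdom h L hm h0 hL y (hAi y)) e1
    simpa using this
  have hJ : Tendsto J atTop (𝓝 0) := by
    refine (tendsto_integral_mul_exp_atTop fun t => k t * F (I * t)).congr fun y => ?_
    exact integral_congr_ae (.of_forall fun t => by ring)
  have hB : Tendsto B atTop (𝓝 (∫ u, κ u)) := by
    refine ((aecover_Ioi (μ := volume) (a := fun y : ℝ => -y)
      tendsto_neg_atTop_atBot).integral_tendsto_of_countably_generated hκi).congr fun y => ?_
    rw [← integral_indicator measurableSet_Ioi, ← integral_sub_right_eq_self _ y]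
    refine integral_congr_ae (.of_forall fun x => ?_)
    by_cases hx : 0 < x <;> simp [H, indicator, hx]
  simp only [hA]
  simpa using ((continuous_re.tendsto _).comp hJ).add (hB.const_mul M)

end Kernel

lemma tendsto_integral_scaled_kernel {K : ℝ → ℝ} (hK : Integrable K) {d : ℝ} (hd : 0 < d) :
    Tendsto (fun l : ℝ => ∫ u in (-d)..d, l * K (l * u)) atTop (𝓝 (∫ u, K u)) := by
  refine (intervalIntegral_tendsto_integral hK (a := fun l : ℝ => l * -d) (b := fun l => l * d)
    (tendsto_id.atTop_mul_const_of_neg (by linarith)) (tendsto_id.atTop_mul_const hd)).congr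
    fun l => ?_
  rw [intervalIntegral.integral_const_mul, intervalIntegral.mul_integral_comp_mul_left]

lemma integral_scaled_kernel (K : ℝ → ℝ) {l : ℝ} (hl : 0 < l) :
    ∫ u, l * K (l * u) = ∫ u, K u := by
  rw [integral_const_mul, Measure.integral_comp_mul_left, abs_of_pos (inv_pos.mpr hl), smul_eq_mul,
    mul_inv_cancel_left₀ hl.ne']

section Tauberian

variable {h κ : ℝ → ℝ} {a L d : ℝ}

lemma mul_integral_kernel_le (ha : 0 ≤ a) (h0 : ∀ x, 0 ≤ h x)
    (hmono : ∀ x y, L ≤ x → x ≤ y → h y ≤ h x * Real.exp (a * (y - x)))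
    (hκ0 : ∀ u, 0 ≤ κ u) (hκi : Integrable κ) (hd : 0 < d) {y : ℝ} (hy : L + 2 * d ≤ y)
    (hi : Integrable fun x => h x * κ (x - (y - d))) :
    h y * ∫ u in (-d)..d, κ u ≤
      Real.exp (2 * a * d) * ∫ x, h x * κ (x - (y - d)) := by
  have e : ∫ u in (-d)..d, κ u = ∫ x in Icc (y - 2 * d) y, κ (x - (y - d)) := by
    rw [integral_Icc_eq_integral_Ioc, ← intervalIntegral.integral_of_le (by linarith),
      intervalIntegral.integral_comp_sub_right]
    congr 1 <;> ring
  rw [e, ← integral_const_mul, ← integral_const_mul]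
  refine (setIntegral_mono_on (((hκi.comp_sub_right _).const_mul _).integrableOn)
    ((hi.const_mul _).integrableOn) measurableSet_Icc fun x hx => ?_).trans
    (setIntegral_le_integral (hi.const_mul _) (.of_forall fun x => ?_))
  · rw [← mul_assoc]
    refine mul_le_mul_of_nonneg_right ?_ (hκ0 _)
    refine (hmono x y (by linarith [hx.1]) hx.2).trans ?_
    rw [mul_comm]
    refine mul_le_mul_of_nonneg_right (Real.exp_le_exp.mpr ?_) (h0 x)
    nlinarith [hx.1]
  · exact mul_nonneg (Real.exp_pos _).le (mul_nonneg (h0 x) (hκ0 _))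

lemma integral_kernel_le (ha : 0 ≤ a) (h0 : ∀ x, 0 ≤ h x)
    (hmono : ∀ x y, L ≤ x → x ≤ y → h y ≤ h x * Real.exp (a * (y - x)))
    {C : ℝ} (hC : ∀ x, h x ≤ C)
    (hκ0 : ∀ u, 0 ≤ κ u) (hκi : Integrable κ) (hd : 0 < d) {y : ℝ} (hy : L ≤ y)
    (hi : Integrable fun x => h x * κ (x - (y + d))) :
    ∫ x, h x * κ (x - (y + d)) ≤
      h y * Real.exp (2 * a * d) * (∫ u, κ u) + C * ((∫ u, κ u) - ∫ u in (-d)..d, κ u) := by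
  have hκi' : Integrable fun x => κ (x - (y + d)) := hκi.comp_sub_right _
  have e1 : ∫ u in (-d)..d, κ u = ∫ x in Icc y (y + 2 * d), κ (x - (y + d)) := by
    rw [integral_Icc_eq_integral_Ioc, ← intervalIntegral.integral_of_le (by linarith),
      intervalIntegral.integral_comp_sub_right]
    congr 1 <;> ring
  have e2 : ∫ u, κ u = ∫ x, κ (x - (y + d)) := (integral_sub_right_eq_self _ _).symm
  have e3 := integral_add_compl (measurableSet_Icc (a := y) (b := y + 2 * d)) hκi'
  have hp : 0 ≤ ∫ x in (Icc y (y + 2 * d))ᶜ, κ (x - (y + d)) :=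
    integral_nonneg fun x => hκ0 _
  rw [← integral_add_compl (measurableSet_Icc (a := y) (b := y + 2 * d)) hi, e1, e2]
  refine add_le_add ?_ ?_
  · calc _ ≤ ∫ x in Icc y (y + 2 * d), h y * Real.exp (2 * a * d) * κ (x - (y + d)) := by
          refine setIntegral_mono_on hi.integrableOn (hκi'.const_mul _).integrableOn
            measurableSet_Icc fun x hx => mul_le_mul_of_nonneg_right ?_ (hκ0 _)
          refine (hmono y x hy hx.1).trans (mul_le_mul_of_nonneg_left ?_ (h0 y))
          refine Real.exp_le_exp.mpr ?_
          nlinarith [hx.2]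
      _ ≤ _ := by
          rw [integral_const_mul]
          exact mul_le_mul_of_nonneg_left (by linarith) (mul_nonneg (h0 y) (Real.exp_pos _).le)
  · calc _ ≤ ∫ x in (Icc y (y + 2 * d))ᶜ, C * κ (x - (y + d)) :=
          setIntegral_mono hi.integrableOn (hκi'.const_mul _).integrableOn
            fun x => mul_le_mul_of_nonneg_right (hC x) (hκ0 _)
      _ = _ := by rw [integral_const_mul, ← e3]; ring

/-- A Tauberian theorem for the scalings of one nonnegative kernel. -/
theorem tendsto_of_tendsto_integral_kernel {M : ℝ} (ha : 0 ≤ a)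
    (h0 : ∀ x, 0 ≤ h x) (hL : ∀ x < L, h x = 0)
    (hmono : ∀ x y, L ≤ x → x ≤ y → h y ≤ h x * Real.exp (a * (y - x)))
    {K : ℝ → ℝ} (hK0 : ∀ u, 0 ≤ K u) (hKi : Integrable K) (hKpos : 0 < ∫ u, K u)
    (hi : ∀ l > 0, ∀ y, Integrable fun x => h x * (l * K (l * (x - y))))
    (hlim : ∀ l > 0, Tendsto (fun y => ∫ x, h x * (l * K (l * (x - y)))) atTop
      (𝓝 (M * ∫ u, K u))) :
    Tendsto h atTop (𝓝 M) := by
  set c := ∫ u, K u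
  have hκ0 {l : ℝ} (hl : 0 < l) (u : ℝ) : 0 ≤ l * K (l * u) := mul_nonneg hl.le (hK0 _)
  have hκi {l : ℝ} (hl : 0 < l) : Integrable fun u => l * K (l * u) :=
    (hKi.comp_mul_left' hl.ne').const_mul l
  have hexp (m : ℝ) : Tendsto (fun d : ℝ => Real.exp (2 * a * d) * m) (𝓝[>] 0) (𝓝 m) := by
    have : Continuous fun d : ℝ => Real.exp (2 * a * d) * m := by fun_prop
    simpa using (this.tendsto 0).mono_left nhdsWithin_le_nhds
  have hpos : ∀ᶠ d : ℝ in 𝓝[>] 0, 0 < d := self_mem_nhdsWithin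
  have upper (m : ℝ) (hMm : M < m) : ∀ᶠ y in atTop, h y < m := by
    obtain ⟨d, hd1, hd⟩ := (((hexp M).eventually_lt_const hMm).and hpos).exists
    have hlt : Real.exp (2 * a * d) * M * c < m * c := mul_lt_mul_of_pos_right hd1 hKpos
    have hsc := tendsto_integral_scaled_kernel hKi hd
    obtain ⟨l, ⟨hl1, hl2⟩, hl⟩ := ((((hsc.const_mul m).eventually_const_lt hlt).and
      (hsc.eventually_const_lt hKpos)).and (eventually_gt_atTop 0)).exists
    have hev := ((((hlim l hl).comp (tendsto_atTop_add_const_right _ (-d) tendsto_id)).const_mul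
      (Real.exp (2 * a * d))).eventually_lt_const (by rw [← mul_assoc]; exact hl1))
    filter_upwards [hev, eventually_ge_atTop (L + 2 * d)] with y hy1 hy2
    have := mul_integral_kernel_le (κ := fun u => l * K (l * u)) ha h0 hmono (hκ0 hl) (hκi hl)
      hd hy2 (hi l hl _)
    exact lt_of_mul_lt_mul_right (this.trans_lt hy1) hl2.le
  obtain ⟨C, hC⟩ : ∃ C, ∀ x, h x ≤ C := by
    obtain ⟨Y, hY⟩ := eventually_atTop.mp (upper (M + 1) (by linarith))
    refine ⟨max (M + 1) (h L * Real.exp (a * (max L Y - L))), fun x => ?_⟩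
    rcases le_total Y x with hx | hx
    · exact (hY x hx).le.trans (le_max_left _ _)
    · refine le_trans ?_ (le_max_right _ _)
      rcases lt_or_ge x L with hx' | hx'
      · rw [hL x hx']
        exact mul_nonneg (h0 _) (Real.exp_pos _).le
      · refine (hmono L x le_rfl hx').trans (mul_le_mul_of_nonneg_left ?_ (h0 L))
        refine Real.exp_le_exp.mpr (mul_le_mul_of_nonneg_left ?_ ha)
        linarith [le_max_right L Y]
  refine tendsto_order.mpr ⟨fun m hm => ?_, upper⟩
  obtain ⟨d, hd1, hd⟩ := (((hexp m).eventually_lt_const hm).and hpos).exists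
  have hlt : Real.exp (2 * a * d) * m * c < M * c - C * (c - c) := by
    rw [sub_self, mul_zero, sub_zero]
    exact mul_lt_mul_of_pos_right hd1 hKpos
  have hsc := tendsto_integral_scaled_kernel hKi hd
  obtain ⟨l, hl1, hl⟩ := ((((hsc.const_sub c).const_mul C).const_sub (M * c)
    |>.eventually_const_lt hlt).and (eventually_gt_atTop 0)).exists
  have hev := ((hlim l hl).comp (tendsto_atTop_add_const_right _ d tendsto_id)).eventually_const_lt
    (lt_sub_iff_add_lt.mp hl1)
  filter_upwards [hev, eventually_ge_atTop L] with y hy1 hy2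
  have := integral_kernel_le (κ := fun u => l * K (l * u)) ha h0 hmono hC (hκ0 hl) (hκi hl)
      hd hy2 (hi l hl _)
  rw [integral_scaled_kernel K hl] at this
  have h2 := hy1.trans_le this
  have h3 : Real.exp (2 * a * d) * m * c < h y * Real.exp (2 * a * d) * c := by linarith
  have h4 := lt_of_mul_lt_mul_right h3 hKpos.le
  rw [mul_comm] at h4
  exact lt_of_mul_lt_mul_right h4 (Real.exp_pos _).le

end Tauberian

/-- A Wiener–Ikehara theorem for functions of bounded exponential growth rate. -/
theorem tendsto_of_laplace_continuation {h : ℝ → ℝ} {a L M : ℝ} (ha : 0 ≤ a) (hm : Measurable h)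
    (h0 : ∀ x, 0 ≤ h x) (hL : ∀ x < L, h x = 0)
    (hmono : ∀ x y, L ≤ x → x ≤ y → h y ≤ h x * Real.exp (a * (y - x)))
    (hexpInt : ∀ ε > 0, Integrable fun x => h x * Real.exp (-(ε * x)))
    {U : Set ℂ} (hU : IsOpen U) (hline : ∀ z : ℂ, z.re = 0 → z ∈ U)
    {F : ℂ → ℂ} (hF : ContinuousOn F U)
    (hFe : ∀ z ∈ U, 0 < z.re → F z = (∫ x : ℝ, (h x : ℂ) * cexp (-(z * x))) - M / z) :
    Tendsto h atTop (𝓝 M) := by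
  have hsupp {l : ℝ} (hl : 0 < l) : HasCompactSupport fun t => triangle (t / l) :=
    hasCompactSupport_triangle.comp_isClosedEmbedding
      (Homeomorph.mulRight₀ l⁻¹ (inv_ne_zero hl.ne')).isClosedEmbedding
  have key (l : ℝ) (hl : 0 < l) := tendsto_integral_mul_kernel hm h0 hL hexpInt hU hline hF hFe
    (k := fun t => triangle (t / l)) (κ := fun u => l * fejerKernel (l * u))
    (continuous_triangle.comp (by fun_prop))
    (hsupp hl)
    (continuous_const.mul (continuous_fejerKernel.comp (by fun_prop)))
    (fun u => mul_nonneg hl.le (fejerKernel_nonneg _))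
    ((integrable_fejerKernel.comp_mul_left' hl.ne').const_mul l)
    (mul_fejerKernel_eq_integral hl)
  refine tendsto_of_tendsto_integral_kernel ha h0 hL hmono fejerKernel_nonneg
    integrable_fejerKernel integral_fejerKernel_pos (fun l hl => (key l hl).1) fun l hl => ?_
  simpa only [integral_scaled_kernel fejerKernel hl] using (key l hl).2

section Tube

variable {N : ℕ} {Ω : Set (EuclideanSpace ℝ (Fin N))}

lemma measurableSet_tailSet (hmeas : MeasurableSet Ω) (t : ℝ) : MeasurableSet (tailSet N Ω t) :=
  hmeas.inter (measurableSet_le measurable_const measurable_norm)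

lemma volume_tailSet_lt_top (hfin : volume Ω < ⊤) (t : ℝ) : volume (tailSet N Ω t) < ⊤ :=
  (measure_mono fun _ hx => hx.1).trans_lt hfin

lemma antitone_tubeVol (hfin : volume Ω < ⊤) : Antitone (tubeVol N Ω) := fun _ _ hst =>
  ENNReal.toReal_mono (volume_tailSet_lt_top hfin _).ne
    (measure_mono fun _ hx => ⟨hx.1, hst.trans hx.2⟩)

lemma tubeVol_nonneg (t : ℝ) : 0 ≤ tubeVol N Ω t := ENNReal.toReal_nonneg

lemma volume_tailSet_div (hfin : volume Ω < ⊤) {t : ℝ} (ht : 0 < t) (r : ℝ) :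
    volume (tailSet N Ω t) / ENNReal.ofReal (t ^ ((N : ℝ) + r)) =
      ENNReal.ofReal (tubeVol N Ω t / t ^ ((N : ℝ) + r)) := by
  rw [ENNReal.ofReal_div_of_pos (Real.rpow_pos_of_pos ht _), tubeVol,
    ENNReal.ofReal_toReal (volume_tailSet_lt_top hfin t).ne]

lemma tubeVol_le_rpow (hfin : volume Ω < ⊤) (hD : upperMinkDim N Ω < -(N : ℝ)) {r : ℝ}
    (hr : upperMinkDim N Ω < r) : ∀ᶠ t : ℝ in atTop, tubeVol N Ω t ≤ t ^ ((N : ℝ) + r) := by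
  have hne : {r : ℝ | upperMinkContent N Ω r = 0}.Nonempty := by
    by_contra h
    rw [not_nonempty_iff_eq_empty] at h
    rw [upperMinkDim, h, Real.sInf_empty] at hD
    have : (0 : ℝ) ≤ N := Nat.cast_nonneg N
    linarith
  obtain ⟨p, hp, hpr⟩ := exists_lt_of_csInf_lt hne hr
  have hlt := eventually_lt_of_limsup_lt
    (show upperMinkContent N Ω p < 1 by rw [show upperMinkContent N Ω p = 0 from hp]; simp)
  filter_upwards [hlt, eventually_ge_atTop 1] with t ht ht1
  have ht0 : 0 < t := by linarith
  rw [volume_tailSet_div hfin ht0, ENNReal.ofReal_lt_one, div_lt_one (Real.rpow_pos_of_pos ht0 _)]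
    at ht
  exact ht.le.trans (Real.rpow_le_rpow_of_exponent_le ht1 (by linarith))

lemma integrableOn_rpow_mul_tubeVol (hfin : volume Ω < ⊤) (hD : upperMinkDim N Ω < -(N : ℝ))
    {T : ℝ} (hT : 0 < T) {σ : ℝ} (hσ : upperMinkDim N Ω < σ) :
    IntegrableOn (fun t : ℝ => t ^ (-σ - N - 1) * tubeVol N Ω t) (Ioi T) := by
  obtain ⟨r, hr1, hr2⟩ := exists_between hσ
  obtain ⟨X, hX⟩ := eventually_atTop.mp (tubeVol_le_rpow hfin hD hr1)
  have hTY : T ≤ max T X := le_max_left _ _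
  have hcont (s : Set ℝ) (hs : s ⊆ Ici T) : ContinuousOn (fun t : ℝ => t ^ (-σ - N - 1)) s :=
    continuousOn_id.rpow_const fun t ht => Or.inl (hT.trans_le (hs ht)).ne'
  rw [← Ioc_union_Ioi_eq_Ioi hTY]
  refine IntegrableOn.union ?_ ?_
  · refine IntegrableOn.mono_set ?_ Ioc_subset_Icc_self
    exact ((antitone_tubeVol hfin).antitoneOn _ |>.integrableOn_isCompact
      isCompact_Icc).continuousOn_mul (hcont _ fun t ht => ht.1) isCompact_Icc
  · refine (integrableOn_Ioi_rpow_of_lt (show r - σ - 1 < -1 by linarith)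
      (hT.trans_le hTY)).mono' ?_ ?_
    · exact ((hcont _ fun t ht => hTY.trans (le_of_lt ht)).aestronglyMeasurable
        measurableSet_Ioi).mul (antitone_tubeVol hfin).measurable.aestronglyMeasurable
    · refine (ae_restrict_iff' measurableSet_Ioi).mpr (.of_forall fun t ht => ?_)
      have ht0 : 0 < t := (hT.trans_le hTY).trans ht
      rw [Real.norm_of_nonneg (mul_nonneg (Real.rpow_nonneg ht0.le _) (tubeVol_nonneg t))]
      calc _ ≤ t ^ (-σ - N - 1) * t ^ ((N : ℝ) + r) := by
            gcongr
            exact hX t ((le_max_right T X).trans (le_of_lt ht))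
        _ = _ := by rw [← Real.rpow_add ht0]; congr 1; ring

variable (N Ω) in
/-- The tube function in the logarithmic variable, normalized by its growth rate and cut off to
the left of `log T`. -/
def logTube (T x : ℝ) : ℝ :=
  (Ici (Real.log T)).indicator
    (fun x => Real.exp (-(N + upperMinkDim N Ω) * x) * tubeVol N Ω (Real.exp x)) x

lemma logTube_of_ge {T x : ℝ} (hx : Real.log T ≤ x) : logTube N Ω T x =
    Real.exp (-(N + upperMinkDim N Ω) * x) * tubeVol N Ω (Real.exp x) :=
  indicator_of_mem (s := Ici (Real.log T)) hx _

lemma image_exp_Ioi_log {T : ℝ} (hT : 0 < T) : Real.exp '' Ioi (Real.log T) = Ioi T := by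
  ext t
  refine ⟨?_, fun ht => ⟨Real.log t, Real.log_lt_log hT ht, Real.exp_log (hT.trans ht)⟩⟩
  rintro ⟨x, hx, rfl⟩
  exact (Real.log_lt_iff_lt_exp hT).mp hx

lemma integrable_logTube_mul_exp (hfin : volume Ω < ⊤) (hD : upperMinkDim N Ω < -(N : ℝ))
    {T : ℝ} (hT : 0 < T) {ε : ℝ} (hε : 0 < ε) :
    Integrable fun x => logTube N Ω T x * Real.exp (-(ε * x)) := by
  have h := integrableOn_rpow_mul_tubeVol hfin hD hT (σ := upperMinkDim N Ω + ε) (by linarith)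
  rw [← image_exp_Ioi_log hT, integrableOn_image_iff_integrableOn_abs_deriv_smul measurableSet_Ioi
    (fun x _ => (Real.hasDerivAt_exp x).hasDerivWithinAt) Real.exp_injective.injOn,
    ← integrableOn_Ici_iff_integrableOn_Ioi, ← integrable_indicator_iff measurableSet_Ici] at h
  refine h.congr (.of_forall fun x => ?_)
  by_cases hx : x ∈ Ici (Real.log T)
  · simp only [logTube, indicator_of_mem hx, smul_eq_mul, abs_of_pos (Real.exp_pos x)]
    rw [← Real.exp_mul, ← mul_assoc, ← Real.exp_add, mul_right_comm, ← Real.exp_add]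
    congr 2
    ring
  · simp only [logTube, indicator_of_notMem hx, zero_mul]

lemma integral_logTube_mul_exp {T : ℝ} (hT : 0 < T) (z : ℂ) :
    ∫ x : ℝ, (logTube N Ω T x : ℂ) * cexp (-(z * x)) =
      tubeZeta N Ω T ((upperMinkDim N Ω : ℝ) + z) := by
  rw [tubeZeta, ← image_exp_Ioi_log hT, integral_image_eq_integral_abs_deriv_smul measurableSet_Ioi
    (fun x _ => (Real.hasDerivAt_exp x).hasDerivWithinAt) Real.exp_injective.injOn,
    ← integral_Ici_eq_integral_Ioi, ← integral_indicator measurableSet_Ici]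
  refine integral_congr_ae (.of_forall fun x => ?_)
  by_cases hx : x ∈ Ici (Real.log T)
  · simp only [logTube, indicator_of_mem hx, real_smul, abs_of_pos (Real.exp_pos x)]
    have hne : ((Real.exp x : ℝ) : ℂ) ≠ 0 := by exact_mod_cast (Real.exp_pos x).ne'
    rw [cpow_def_of_ne_zero hne, ← ofReal_log (Real.exp_pos x).le, Real.log_exp]
    push_cast
    rw [mul_right_comm, ← Complex.exp_add, ← mul_assoc, ← Complex.exp_add]
    congr 2
    ring
  · simp only [logTube, indicator_of_notMem hx, ofReal_zero, zero_mul]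

lemma measurable_logTube (hfin : volume Ω < ⊤) (T : ℝ) : Measurable (logTube N Ω T) := by
  have := (antitone_tubeVol hfin).measurable
  exact Measurable.indicator (by fun_prop) measurableSet_Ici

lemma logTube_nonneg (T x : ℝ) : 0 ≤ logTube N Ω T x :=
  indicator_nonneg (fun _ _ => mul_nonneg (Real.exp_pos _).le (tubeVol_nonneg _)) x

lemma logTube_le_mul_exp (hfin : volume Ω < ⊤) {T x y : ℝ} (hx : Real.log T ≤ x) (hxy : x ≤ y) :
    logTube N Ω T y ≤
      logTube N Ω T x * Real.exp (-(N + upperMinkDim N Ω) * (y - x)) := by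
  rw [logTube_of_ge hx, logTube_of_ge (hx.trans hxy), mul_right_comm, ← Real.exp_add]
  have := antitone_tubeVol hfin (Real.exp_le_exp.mpr hxy)
  rw [show -(N + upperMinkDim N Ω) * x + -(N + upperMinkDim N Ω) * (y - x) =
    -(N + upperMinkDim N Ω) * y by ring]
  gcongr

lemma nonneg_residue {T : ℝ} (hT : 0 < T) {U : Set ℂ} (hU : IsOpen U)
    (hDU : ((upperMinkDim N Ω : ℝ) : ℂ) ∈ U) {g : ℂ → ℂ}
    (hge : ∀ s ∈ U, upperMinkDim N Ω < s.re → g s = tubeZeta N Ω T s) {r : ℂ}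
    (hlim : Tendsto (fun s : ℂ => (s - ((upperMinkDim N Ω : ℝ) : ℂ)) * g s)
        (𝓝[≠] ((upperMinkDim N Ω : ℝ) : ℂ)) (𝓝 r)) :
    0 ≤ r.re ∧ r = (r.re : ℂ) := by
  set D := upperMinkDim N Ω
  have hc : Continuous fun ε : ℝ => ((D : ℝ) : ℂ) + ε := by fun_prop
  have ht : Tendsto (fun ε : ℝ => ((D : ℝ) : ℂ) + ε) (𝓝[>] 0) (𝓝 (D : ℂ)) := by
    simpa using (hc.tendsto 0).mono_left nhdsWithin_le_nhds
  have hpos : ∀ᶠ ε : ℝ in 𝓝[>] 0, 0 < ε := self_mem_nhdsWithin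
  have ht' : Tendsto (fun ε : ℝ => ((D : ℝ) : ℂ) + ε) (𝓝[>] 0) (𝓝[≠] (D : ℂ)) :=
    tendsto_nhdsWithin_iff.mpr ⟨ht, hpos.mono fun ε hε => by simpa using hε.ne'⟩
  have h1 := hlim.comp ht'
  have h2 : ∀ᶠ ε : ℝ in 𝓝[>] 0, ((fun s : ℂ => (s - (D : ℂ)) * g s) ∘ fun ε : ℝ => (D : ℂ) + ε) ε =
      ((ε * ∫ x, logTube N Ω T x * Real.exp (-(ε * x)) : ℝ) : ℂ) := by
    filter_upwards [ht.eventually (hU.mem_nhds hDU), hpos] with ε hεU hε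
    simp only [Function.comp]
    rw [hge _ hεU (by simpa using hε), ← integral_logTube_mul_exp hT, ofReal_mul,
      ← integral_complex_ofReal, add_sub_cancel_left]
    push_cast
    rfl
  have h3 := h1.congr' h2
  constructor
  · refine ge_of_tendsto ((continuous_re.tendsto r).comp h3) (hpos.mono fun ε hε => ?_)
    simp only [Function.comp, ofReal_re]
    exact mul_nonneg hε.le (integral_nonneg fun x =>
      mul_nonneg (logTube_nonneg _ _) (Real.exp_pos _).le)
  · refine Complex.ext (by simp) ?_
    have h4 := (continuous_im.tendsto r).comp h3
    simp only [Function.comp_def, ofReal_im] at h4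
    simpa using (tendsto_nhds_unique h4 tendsto_const_nhds)

/-- Subtracting the principal part of a simple pole leaves a function that extends continuously. -/
lemma exists_continuousOn_sub_pole {U : Set ℂ} {c r : ℂ} (hU : U ∈ 𝓝 c) {g : ℂ → ℂ}
    (hg : DifferentiableOn ℂ g (U \ {c}))
    (hlim : Tendsto (fun s : ℂ => (s - c) * g s) (𝓝[≠] c) (𝓝 r)) :
    ∃ F : ℂ → ℂ, ContinuousOn F U ∧ ∀ s, s ≠ c → F s = g s - r / (s - c) := by
  let φ : ℂ → ℂ := Function.update (fun s => (s - c) * g s) c r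
  have hφne (s : ℂ) (hs : s ≠ c) : φ s = (s - c) * g s := Function.update_of_ne hs _ _
  have hφ : DifferentiableOn ℂ φ U := by
    refine (differentiableOn_compl_singleton_and_continuousAt_iff hU).mp ⟨?_, ?_⟩
    · exact ((differentiableOn_id.sub_const c).mul hg).congr fun s hs => hφne s hs.2
    · exact continuousAt_update_same.mpr hlim
  refine ⟨dslope φ c, ((differentiableOn_dslope hU).mpr hφ).continuousOn, fun s hs => ?_⟩
  have hsc : s - c ≠ 0 := sub_ne_zero.mpr hs
  rw [dslope_of_ne _ hs, slope_def_field, hφne s hs, show φ c = r from Function.update_self _ _ _]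
  field_simp

theorem tendsto_tubeVol_of_tubeZeta_continuation (hfin : volume Ω < ⊤) {T : ℝ} (hT : 0 < T)
    (hD : upperMinkDim N Ω < -(N : ℝ)) {U : Set ℂ} (hU : IsOpen U)
    (hline : {s : ℂ | s.re = upperMinkDim N Ω} ⊆ U) {g : ℂ → ℂ}
    (hg : DifferentiableOn ℂ g (U \ {((upperMinkDim N Ω : ℝ) : ℂ)}))
    (hge : ∀ s ∈ U, upperMinkDim N Ω < s.re → g s = tubeZeta N Ω T s) {r : ℂ} (hr : r ≠ 0)
    (hlim : Tendsto (fun s : ℂ => (s - ((upperMinkDim N Ω : ℝ) : ℂ)) * g s)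
        (𝓝[≠] ((upperMinkDim N Ω : ℝ) : ℂ)) (𝓝 r)) :
    ∃ M : ℝ, 0 < M ∧ r = (M : ℂ) ∧
      Tendsto (fun t : ℝ => tubeVol N Ω t / t ^ ((N : ℝ) + upperMinkDim N Ω)) atTop (𝓝 M) := by
  have hDU : ((upperMinkDim N Ω : ℝ) : ℂ) ∈ U := hline (by simp)
  obtain ⟨hr0, hreal⟩ := nonneg_residue hT hU hDU hge hlim
  refine ⟨r.re, lt_of_le_of_ne hr0 fun h => hr (by rw [hreal, ← h, ofReal_zero]), hreal, ?_⟩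
  obtain ⟨F, hF, hFg⟩ := exists_continuousOn_sub_pole (hU.mem_nhds hDU) hg hlim
  have hc : Continuous fun z : ℂ => ((upperMinkDim N Ω : ℝ) : ℂ) + z := by fun_prop
  have key : Tendsto (logTube N Ω T) atTop (𝓝 r.re) := by
    refine tendsto_of_laplace_continuation (a := -(N + upperMinkDim N Ω)) (L := Real.log T)
      (U := (fun z : ℂ => ((upperMinkDim N Ω : ℝ) : ℂ) + z) ⁻¹' U)
      (F := fun z => F ((upperMinkDim N Ω : ℝ) + z))
      (by linarith) (measurable_logTube hfin T) (logTube_nonneg T)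
      (fun x hx => indicator_of_notMem (by simpa using hx) _)
      (fun x y hx hxy => logTube_le_mul_exp hfin hx hxy)
      (fun ε hε => integrable_logTube_mul_exp hfin hD hT hε) (hU.preimage hc)
      (fun z hz => hline (by simp [hz])) (hF.comp hc.continuousOn fun z hz => hz) ?_
    intro z hz hz0
    have hne : ((upperMinkDim N Ω : ℝ) : ℂ) + z ≠ (upperMinkDim N Ω : ℝ) := by
      rw [Ne, add_eq_left]
      rintro rfl
      simp at hz0
    rw [hFg _ hne, hge _ hz (by simpa using hz0), integral_logTube_mul_exp hT,
      add_sub_cancel_left, ← hreal]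
  refine (key.comp Real.tendsto_log_atTop).congr' ?_
  filter_upwards [eventually_ge_atTop T] with t ht
  have ht0 : 0 < t := hT.trans_le ht
  rw [Function.comp, logTube_of_ge (Real.log_le_log hT ht), Real.exp_log ht0, div_eq_mul_inv,
    ← Real.rpow_neg ht0.le, Real.rpow_def_of_pos ht0, mul_comm, mul_comm (Real.log t)]

lemma lowerMinkDim_eq_of_tendsto (hfin : volume Ω < ⊤) {D M : ℝ} (hM : 0 < M)
    (h : Tendsto (fun t : ℝ => tubeVol N Ω t / t ^ ((N : ℝ) + D)) atTop (𝓝 M)) :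
    lowerMinkDim N Ω = D := by
  have hev (r : ℝ) : (fun t : ℝ => volume (tailSet N Ω t) / ENNReal.ofReal (t ^ ((N : ℝ) + r)))
      =ᶠ[atTop] fun t => ENNReal.ofReal (tubeVol N Ω t / t ^ ((N : ℝ) + D) * t ^ (D - r)) := by
    filter_upwards [eventually_gt_atTop 0] with t ht
    rw [volume_tailSet_div hfin ht, div_mul_eq_mul_div, mul_div_assoc, ← Real.rpow_sub ht,
      div_eq_mul_inv, ← Real.rpow_neg ht.le]
    congr 3
    ring
  suffices {r : ℝ | lowerMinkContent N Ω r = 0} = Ioi D by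
    rw [lowerMinkDim, this, csInf_Ioi]
  ext r
  simp only [mem_ofPred_eq, mem_Ioi, lowerMinkContent, liminf_congr (hev r)]
  refine ⟨fun h0 => ?_, fun hr => ?_⟩
  · by_contra! hr
    have : ENNReal.ofReal (M / 2) ≤ liminf (fun t : ℝ =>
        ENNReal.ofReal (tubeVol N Ω t / t ^ ((N : ℝ) + D) * t ^ (D - r))) atTop := by
      refine le_liminf_of_le (by isBoundedDefault) ?_
      filter_upwards [h.eventually_const_lt (half_lt_self hM), eventually_ge_atTop 1] with t h1 h2
      refine ENNReal.ofReal_le_ofReal (h1.le.trans ?_)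
      exact le_mul_of_one_le_right (by linarith) (Real.one_le_rpow h2 (by linarith))
    rw [h0, nonpos_iff_eq_zero, ENNReal.ofReal_eq_zero] at this
    linarith
  · have h1 : Tendsto (fun t : ℝ => t ^ (D - r)) atTop (𝓝 0) := by
      simpa using tendsto_rpow_neg_atTop (show 0 < r - D by linarith)
    simpa using (ENNReal.tendsto_ofReal (h.mul h1)).liminf_eq

/-- The functional equation between the distance and tube zeta functions at infinity. -/
lemma distZeta_eq (hmeas : MeasurableSet Ω) (hfin : volume Ω < ⊤)
    (hD : upperMinkDim N Ω < -(N : ℝ)) {T : ℝ} (hT : 0 < T) {s : ℂ}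
    (hs : upperMinkDim N Ω < s.re) (hsN : s.re < -(N : ℝ)) :
    distZeta N Ω T s = (T : ℂ) ^ (-s - N) * tubeVol N Ω T + (-s - N) * tubeZeta N Ω T s := by
  set b : ℂ := -s - N with hb
  have hbre : 0 < b.re := by simp [hb]; linarith
  have hb0 : b ≠ 0 := fun h => by simp [h] at hbre
  set μ := (volume : Measure (EuclideanSpace ℝ (Fin N))).restrict (tailSet N Ω T)
  have : IsFiniteMeasure μ := ⟨by
    rw [Measure.restrict_apply_univ]; exact volume_tailSet_lt_top hfin T⟩
  have hμV (t : ℝ) (ht : T < t) : μ.real {x | t ≤ ‖x‖} = tubeVol N Ω t := by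
    rw [measureReal_def, Measure.restrict_apply (measurableSet_le measurable_const measurable_norm),
      tubeVol]
    congr 2
    ext x
    exact ⟨fun h => ⟨h.2.1, h.1⟩, fun h => ⟨h.2, h.1, ht.le.trans h.2⟩⟩
  let f : EuclideanSpace ℝ (Fin N) → ℝ → ℂ := fun x t =>
    (Iic ‖x‖).indicator (fun t : ℝ => (t : ℂ) ^ (b - 1)) t
  have hfx (t : ℝ) : (fun x => f x t) = {x | t ≤ ‖x‖}.indicator fun _ => (t : ℂ) ^ (b - 1) := by
    ext x; by_cases hx : t ≤ ‖x‖ <;> simp [f, hx]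
  have hset (t : ℝ) : MeasurableSet {x : EuclideanSpace ℝ (Fin N) | t ≤ ‖x‖} :=
    measurableSet_le measurable_const measurable_norm
  have hfm : Measurable (Function.uncurry f) := by
    have : Function.uncurry f = {p : EuclideanSpace ℝ (Fin N) × ℝ | p.2 ≤ ‖p.1‖}.indicator
        fun p => (p.2 : ℂ) ^ (b - 1) := by
      ext ⟨x, t⟩; by_cases hx : t ≤ ‖x‖ <;> simp [Function.uncurry, f, hx]
    rw [this]
    exact Measurable.indicator (by fun_prop) (measurableSet_le (by fun_prop) (by fun_prop))
  have hi : Integrable (Function.uncurry f) (μ.prod (volume.restrict (Ioi T))) := by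
    refine (integrable_prod_iff' hfm.aestronglyMeasurable).mpr ⟨.of_forall fun t => ?_, ?_⟩
    · simp only [Function.uncurry, hfx]
      exact (integrable_const _).indicator (hset t)
    · refine (integrableOn_rpow_mul_tubeVol hfin hD hT hs).congr ?_
      refine (ae_restrict_iff' measurableSet_Ioi).mpr (.of_forall fun t ht => ?_)
      have e : (fun x => ‖Function.uncurry f (x, t)‖) =
          {x | t ≤ ‖x‖}.indicator fun _ => t ^ (-s.re - N - 1) := by
        ext x
        by_cases hx : t ≤ ‖x‖
        · simp [Function.uncurry, f, hx, norm_cpow_eq_rpow_re_of_pos (hT.trans ht), hb]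
        · simp [Function.uncurry, f, hx]
      simp only [e]
      rw [integral_indicator (hset t), setIntegral_const, hμV t ht, smul_eq_mul, mul_comm]
  have hinner (x : EuclideanSpace ℝ (Fin N)) (hx : x ∈ tailSet N Ω T) :
      ∫ t in Ioi T, f x t = ((‖x‖ : ℂ) ^ b - (T : ℂ) ^ b) / b := by
    simp only [f]
    rw [setIntegral_indicator measurableSet_Iic, Ioi_inter_Iic,
      ← intervalIntegral.integral_of_le hx.2, integral_cpow (Or.inl (by simpa using hbre))]
    simp
  have hinner' : (fun x => ∫ t in Ioi T, f x t) =ᵐ[μ]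
      fun x => ((‖x‖ : ℂ) ^ b - (T : ℂ) ^ b) / b :=
    (ae_restrict_iff' (measurableSet_tailSet hmeas T)).mpr (.of_forall hinner)
  have hni : Integrable (fun x => (‖x‖ : ℂ) ^ b) μ := by
    have h1 := ((hi.integral_prod_left.congr hinner').mul_const b).add
      (integrable_const ((T : ℂ) ^ b))
    refine h1.congr (.of_forall fun x => ?_)
    simp [hb0]
  have hswap := integral_integral_swap hi
  rw [integral_congr_ae hinner', integral_div, integral_sub hni (integrable_const _),
    integral_const] at hswap
  have hμT : μ.real univ = tubeVol N Ω T := by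
    rw [measureReal_def, Measure.restrict_apply_univ, tubeVol]
  have hright : ∫ t in Ioi T, ∫ x, f x t ∂μ = tubeZeta N Ω T s := by
    refine setIntegral_congr_fun measurableSet_Ioi fun t ht => ?_
    simp only [hfx]
    rw [integral_indicator (hset t), setIntegral_const, hμV t ht, real_smul, mul_comm]
  rw [hright, hμT, real_smul, div_eq_iff hb0] at hswap
  rw [distZeta, ← hb]
  linear_combination hswap

theorem tendsto_tubeVol_of_distZeta_continuation (hmeas : MeasurableSet Ω) (hfin : volume Ω < ⊤)
    {T : ℝ} (hT : 0 < T) (hD : upperMinkDim N Ω < -(N : ℝ)) {U : Set ℂ} (hU : IsOpen U)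
    (hline : {s : ℂ | s.re = upperMinkDim N Ω} ⊆ U) {g : ℂ → ℂ}
    (hg : DifferentiableOn ℂ g (U \ {((upperMinkDim N Ω : ℝ) : ℂ)}))
    (hge : ∀ s ∈ U, upperMinkDim N Ω < s.re → g s = distZeta N Ω T s) {r : ℂ} (hr : r ≠ 0)
    (hlim : Tendsto (fun s : ℂ => (s - ((upperMinkDim N Ω : ℝ) : ℂ)) * g s)
        (𝓝[≠] ((upperMinkDim N Ω : ℝ) : ℂ)) (𝓝 r)) :
    ∃ M : ℝ, 0 < M ∧ r = ((-((N : ℝ) + upperMinkDim N Ω) * M : ℝ) : ℂ) ∧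
      Tendsto (fun t : ℝ => tubeVol N Ω t / t ^ ((N : ℝ) + upperMinkDim N Ω)) atTop (𝓝 M) := by
  have hT0 : (T : ℂ) ≠ 0 := by exact_mod_cast hT.ne'
  have hne (s : ℂ) (hs : s.re < -(N : ℝ)) : -s - (N : ℂ) ≠ 0 := fun h => by
    have := congrArg Complex.re h
    simp at this
    linarith
  have hDne := hne ((upperMinkDim N Ω : ℝ) : ℂ) (by simpa using hD)
  have hcor : Differentiable ℂ fun s : ℂ => (T : ℂ) ^ (-s - N) * tubeVol N Ω T :=
    Differentiable.mul_const (Differentiable.const_cpow (by fun_prop) (.inl hT0)) _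
  obtain ⟨M, hM, hrM, hlimM⟩ := tendsto_tubeVol_of_tubeZeta_continuation hfin hT hD
    (U := U ∩ {s | s.re < -(N : ℝ)})
    (g := fun s => (g s - (T : ℂ) ^ (-s - N) * tubeVol N Ω T) / (-s - N))
    (r := r / (-((upperMinkDim N Ω : ℝ) : ℂ) - N))
    (hU.inter (isOpen_lt continuous_re continuous_const))
    (fun s hs => ⟨hline hs, by rw [mem_ofPred_eq] at hs ⊢; rwa [hs]⟩)
    (((hg.mono fun s hs => ⟨hs.1.1, hs.2⟩).sub hcor.differentiableOn).div
      (by fun_prop) fun s hs => hne s hs.1.2)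
    (fun s hs hsD => by
      rw [hge s hs.1 hsD, distZeta_eq hmeas hfin hD hT hsD hs.2, add_sub_cancel_left,
        mul_div_cancel_left₀ _ (hne s hs.2)])
    (div_ne_zero hr hDne) (by
      have h1 : Tendsto (fun s : ℂ => (s - ((upperMinkDim N Ω : ℝ) : ℂ)) *
          ((T : ℂ) ^ (-s - N) * tubeVol N Ω T)) (𝓝[≠] ((upperMinkDim N Ω : ℝ) : ℂ)) (𝓝 0) := by
        have : Continuous fun s : ℂ => (s - ((upperMinkDim N Ω : ℝ) : ℂ)) *
          ((T : ℂ) ^ (-s - N) * tubeVol N Ω T) := by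
          have := hcor.continuous
          fun_prop
        simpa using (this.tendsto ((upperMinkDim N Ω : ℝ) : ℂ)).mono_left nhdsWithin_le_nhds
      have h2 : Tendsto (fun s : ℂ => -s - (N : ℂ)) (𝓝[≠] ((upperMinkDim N Ω : ℝ) : ℂ))
          (𝓝 (-((upperMinkDim N Ω : ℝ) : ℂ) - N)) :=
        ((by fun_prop : Continuous fun s : ℂ => -s - (N : ℂ)).tendsto _).mono_left
          nhdsWithin_le_nhds
      have h3 := (hlim.sub h1).div h2 hDne
      rw [sub_zero] at h3
      refine h3.congr fun s => ?_
      simp only [Pi.div_apply]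
      ring)
  refine ⟨M, hM, ?_, hlimM⟩
  rw [div_eq_iff hDne] at hrM
  rw [hrM]
  push_cast
  ring

end Tube

/-- sufficient condition for Minkowski measurability at infinity. If the tube
(resp. distance) zeta function admits a meromorphic continuation to an open connected
neighborhood `U` of the critical line `{Re s = D̄}` whose only pole in `U` is `D̄` and that
pole is simple, then `dim_B(∞,Ω)` exists, equals `D̄`, and `Ω` is Minkowski measurable at
infinity with content the residue (resp. the residue divided by `−(N+D)`). -/
theorem minkowski_measurable_sufficient_condition
    (N : ℕ) (Ω : Set (EuclideanSpace ℝ (Fin N)))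
    (hmeas : MeasurableSet Ω) (hfin : volume Ω < ⊤)
    (T : ℝ) (hT : 0 < T)
    (hD : upperMinkDim N Ω < -(N : ℝ)) :
    (∀ U : Set ℂ, IsOpen U → IsConnected U →
      {s : ℂ | s.re = upperMinkDim N Ω} ⊆ U →
      ∀ g : ℂ → ℂ, DifferentiableOn ℂ g (U \ {((upperMinkDim N Ω : ℝ) : ℂ)}) →
      (∀ s ∈ U, upperMinkDim N Ω < s.re → g s = tubeZeta N Ω T s) →
      ∀ r : ℂ, r ≠ 0 →
      Tendsto (fun s : ℂ => (s - ((upperMinkDim N Ω : ℝ) : ℂ)) * g s)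
        (𝓝[≠] ((upperMinkDim N Ω : ℝ) : ℂ)) (𝓝 r) →
      lowerMinkDim N Ω = upperMinkDim N Ω ∧
      ∃ M : ℝ, 0 < M ∧ r = (M : ℂ) ∧
        Tendsto (fun t : ℝ => tubeVol N Ω t / t ^ ((N : ℝ) + upperMinkDim N Ω))
          atTop (𝓝 M)) ∧
    (∀ U : Set ℂ, IsOpen U → IsConnected U →
      {s : ℂ | s.re = upperMinkDim N Ω} ⊆ U →
      ∀ g : ℂ → ℂ, DifferentiableOn ℂ g (U \ {((upperMinkDim N Ω : ℝ) : ℂ)}) →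
      (∀ s ∈ U, upperMinkDim N Ω < s.re → g s = distZeta N Ω T s) →
      ∀ r : ℂ, r ≠ 0 →
      Tendsto (fun s : ℂ => (s - ((upperMinkDim N Ω : ℝ) : ℂ)) * g s)
        (𝓝[≠] ((upperMinkDim N Ω : ℝ) : ℂ)) (𝓝 r) →
      lowerMinkDim N Ω = upperMinkDim N Ω ∧
      ∃ M : ℝ, 0 < M ∧ r = ((-((N : ℝ) + upperMinkDim N Ω) * M : ℝ) : ℂ) ∧
        Tendsto (fun t : ℝ => tubeVol N Ω t / t ^ ((N : ℝ) + upperMinkDim N Ω))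
          atTop (𝓝 M)) := by
  refine ⟨fun U hU _ hline g hg hge r hr hlim => ?_, fun U hU _ hline g hg hge r hr hlim => ?_⟩
  · obtain ⟨M, hM, hrM, hlimM⟩ :=
      tendsto_tubeVol_of_tubeZeta_continuation hfin hT hD hU hline hg hge hr hlim
    exact ⟨lowerMinkDim_eq_of_tendsto hfin hM hlimM, M, hM, hrM, hlimM⟩
  · obtain ⟨M, hM, hrM, hlimM⟩ :=
      tendsto_tubeVol_of_distZeta_continuation hmeas hfin hT hD hU hline hg hge hr hlim
    exact ⟨lowerMinkDim_eq_of_tendsto hfin hM hlimM, M, hM, hrM, hlimM⟩
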